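/- Assume the setup. Let Γ = (T, m, λ) be a stable [n]-marked metric tree with at most r edges satisfying (H_q) for every q ∈ {1,…,r}; let e_1, …, e_r be its edges listed in decreasing order of length, and for each q let k_q < ℓ_q be the two elements of S_q ∖ {i_q, j_q} at which the minimum in (H_q) is attained. For each q let P_q be the set of edges of T lying both on the path between m(i_q) and m(j_q) and on the path between m(k_q) and m(ℓ_q). Then: (a) for every q ∈ {1,…,r}, the sum of λ(e) over e ∈ P_q equals (ℓ_q − k_q)·B^(n−3−q), and these r linear equations determine λ uniquely (the coefficient matrix with (q,q')-entry equal to 1 if e_{q'} ∈ P_q and 0 otherwise is upper triangular with 1s on the diagonal); (b) there exists ε > 0 such that for every q ∈ {1,…,r} and every length function λ′ : E(T) → ℝ with λ′(e) > 0 and |λ′(e) − λ(e)| < ε for all edges e, the metric tree (T, m, λ′) satisfies (H_q) if and only if the sum of λ′(e) over e ∈ P_q equals (ℓ_q − k_q)·B^(n−3−q). (Paper: Proposition that Trop(H_q) is cut out near Γ by the q-th row of the path matrix equation, Section 6.) -/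

import Mathlib

open scoped Classical

namespace TropPsi

/-- A finite tree with vertices marked by `Fin n` (the `n` legs). -/
structure MTree (n : ℕ) where
  V : Type
  [fintypeV : Fintype V]
  [decEqV : DecidableEq V]
  G : SimpleGraph V
  isTree : G.IsTree
  mark : Fin n → V

attribute [instance] MTree.fintypeV MTree.decEqV

namespace MTree

variable {n : ℕ}

/-- The unique path between two vertices of a tree, as a walk. -/
noncomputable def path (τ : MTree n) (u v : τ.V) : τ.G.Walk u v :=
  (τ.isTree.existsUnique_path u v).exists.choose

/-- An edge lies on the path between `u` and `v`. -/
def onPath (τ : MTree n) (u v : τ.V) (e : Sym2 τ.V) : Prop :=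
  e ∈ (τ.path u v).edges

/-- The set of edges lying both on the path between legs `i` and `j` and on the
path between legs `k` and `l`. -/
def PathSet (τ : MTree n) (i j k l : Fin n) : Set (Sym2 τ.V) :=
  {e | τ.onPath (τ.mark i) (τ.mark j) e ∧ τ.onPath (τ.mark k) (τ.mark l) e}

/-- Stability: at every vertex, degree plus number of legs is at least `3`. -/
def Stable (τ : MTree n) : Prop :=
  ∀ v : τ.V, 3 ≤ {w : τ.V | τ.G.Adj v w}.ncard + {α : Fin n | τ.mark α = v}.ncard

end MTree

/-- A stable `[n]`-marked metric tree: a marked tree together with a length function. -/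
structure MMTree (n : ℕ) extends MTree n where
  len : Sym2 V → ℝ

/-- Equip a marked tree with a length function. -/
def MTree.withLen {n : ℕ} (τ : MTree n) (lam : Sym2 τ.V → ℝ) : MMTree n :=
  { toMTree := τ, len := lam }

namespace MMTree

variable {n : ℕ}

/-- All edges have positive length. -/
def PosLen (Γ : MMTree n) : Prop :=
  ∀ e ∈ Γ.G.edgeSet, 0 < Γ.len e

/-- The distance `d(α,β)` between the legs `α` and `β`. -/
noncomputable def legDist (Γ : MMTree n) (α β : Fin n) : ℝ :=
  ((Γ.toMTree.path (Γ.mark α) (Γ.mark β)).edges.map Γ.len).sum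

/-- The projection coordinate `d_l^{(i,j)}`. -/
noncomputable def proj (Γ : MMTree n) (i j l : Fin n) : ℝ :=
  (Γ.legDist i l + Γ.legDist i j - Γ.legDist j l) / 2

/-- The quantity `d_α^{(i,j)} + α · c` being minimized in condition `(H_q)`;
the leg `α : Fin n` has numerical value `α + 1 ∈ {1, …, n}`. -/
noncomputable def hval (Γ : MMTree n) (i j : Fin n) (c : ℝ) (α : Fin n) : ℝ :=
  Γ.proj i j α + (((α : ℕ) : ℝ) + 1) * c

/-- `α` attains the minimum of `d^{(i,j)} + (·) · c` over `S \ {i, j}`. -/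
def Minimizes (Γ : MMTree n) (S : Finset (Fin n)) (i j : Fin n) (c : ℝ) (α : Fin n) : Prop :=
  α ∈ S \ {i, j} ∧ ∀ γ ∈ S \ {i, j}, Γ.hval i j c α ≤ Γ.hval i j c γ

/-- Condition `(H)`: the minimum is attained at least twice. -/
def CondH (Γ : MMTree n) (S : Finset (Fin n)) (i j : Fin n) (c : ℝ) : Prop :=
  ∃ α β : Fin n, α ≠ β ∧ Γ.Minimizes S i j c α ∧ Γ.Minimizes S i j c β

end MMTree


namespace MTree

variable {n : ℕ} (τ : MTree n)

lemma isPath_path (u v : τ.V) : (τ.path u v).IsPath :=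
  (τ.isTree.existsUnique_path u v).exists.choose_spec

lemma onPath_iff (u v : τ.V) (x : Sym2 τ.V) :
    τ.onPath u v x ↔ ¬ (τ.G.deleteEdges {x}).Reachable u v := by
  constructor
  · rintro h ⟨w⟩
    have hle : τ.G.deleteEdges {x} ≤ τ.G := SimpleGraph.deleteEdges_le _
    have hp : τ.path u v = w.toPath.1.mapLe hle :=
      (τ.isTree.existsUnique_path u v).unique (τ.isPath_path u v)
        ((SimpleGraph.Walk.isPath_mapLe hle).2 w.toPath.2)
    have h' : x ∈ (w.toPath.1.mapLe hle).edges := hp ▸ h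
    rw [SimpleGraph.Walk.edges_mapLe_eq_edges] at h'
    have := SimpleGraph.Walk.edges_subset_edgeSet _ h'
    simp [SimpleGraph.edgeSet_deleteEdges] at this
  · intro h
    by_contra hx
    exact h ⟨(τ.path u v).toDeleteEdge x hx⟩

lemma onPath_comm (u v : τ.V) (x : Sym2 τ.V) : τ.onPath u v x ↔ τ.onPath v u x := by
  rw [onPath_iff, onPath_iff, SimpleGraph.reachable_comm]

lemma reachable_deleteEdges_or (a b u : τ.V) :
    (τ.G.deleteEdges {s(a, b)}).Reachable u a ∨ (τ.G.deleteEdges {s(a, b)}).Reachable u b := by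
  obtain ⟨w⟩ := τ.isTree.1.preconnected u a
  suffices h : ∀ {u c : τ.V} (w : τ.G.Walk u c), c = a →
      (τ.G.deleteEdges {s(a, b)}).Reachable u a ∨ (τ.G.deleteEdges {s(a, b)}).Reachable u b from
    h w rfl
  intro u c w hc
  induction w with
  | nil => exact Or.inl (hc ▸ SimpleGraph.Reachable.refl _)
  | @cons u v c hadj w ih =>
    by_cases hx : s(u, v) = s(a, b)
    · rcases Sym2.eq_iff.1 hx with h | h
      · exact Or.inl (h.1 ▸ SimpleGraph.Reachable.refl _)
      · exact Or.inr (h.1 ▸ SimpleGraph.Reachable.refl _)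
    · have huv : (τ.G.deleteEdges {s(a, b)}).Reachable u v :=
        SimpleGraph.Adj.reachable (by
          simpa [SimpleGraph.deleteEdges_adj] using ⟨hadj, by simpa using hx⟩)
      exact (ih hc).imp huv.trans huv.trans

/-- Removing an edge leaves two classes of vertices. -/
lemma onPath_iff_xor (u v w : τ.V) (x : Sym2 τ.V) :
    τ.onPath v w x ↔ ¬ (τ.onPath u v x ↔ τ.onPath u w x) := by
  induction x with
  | _ a b =>
    simp only [onPath_iff]
    have hu := τ.reachable_deleteEdges_or a b u
    have hv := τ.reachable_deleteEdges_or a b v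
    have hw := τ.reachable_deleteEdges_or a b w
    have tr : ∀ {p q s : τ.V}, (τ.G.deleteEdges {s(a, b)}).Reachable p q →
      (τ.G.deleteEdges {s(a, b)}).Reachable q s → (τ.G.deleteEdges {s(a, b)}).Reachable p s :=
      fun h h' => h.trans h'
    have sy : ∀ {p q : τ.V}, (τ.G.deleteEdges {s(a, b)}).Reachable p q →
      (τ.G.deleteEdges {s(a, b)}).Reachable q p := fun h => h.symm
    constructor
    · intro h h'
      by_cases huv : (τ.G.deleteEdges {s(a, b)}).Reachable u v
      · have huw := not_not.1 (mt h'.2 (not_not.2 huv))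
        exact h (tr (sy huv) huw)
      · have huw := h'.1 huv
        rcases hu with hu | hu <;> rcases hv with hv | hv <;> rcases hw with hw | hw
        · exact h (tr hv (sy hw))
        · exact huv (tr hu (sy hv))
        · exact huw (tr hu (sy hw))
        · exact h (tr hv (sy hw))
        · exact h (tr hv (sy hw))
        · exact huw (tr hu (sy hw))
        · exact huv (tr hu (sy hv))
        · exact h (tr hv (sy hw))
    · intro h hvw
      exact h (not_congr ⟨fun h => tr h hvw, fun h => tr h (sy hvw)⟩)

/-- The splits induced by two edges of a tree are compatible. -/
lemma not_onPath_of_split {x y : Sym2 τ.V} {i j k l : τ.V}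
    (hx : ¬ τ.onPath k j x) (hx' : ¬ τ.onPath i l x)
    (hy : τ.onPath k j y) (hy' : τ.onPath i l y) : ¬ τ.onPath i k x := by
  induction y with
  | _ a b =>
    have key : ∀ {u v : τ.V}, ¬ τ.onPath u v x → τ.onPath u v s(a, b) →
        (τ.G.deleteEdges {x}).Reachable u a := by
      intro u v hxuv hyuv
      have ha : a ∈ (τ.path u v).support := SimpleGraph.Walk.fst_mem_support_of_mem_edges _ hyuv
      exact ⟨((τ.path u v).takeUntil a ha).toDeleteEdge x
        fun h => hxuv (SimpleGraph.Walk.edges_takeUntil_subset_edges _ ha h)⟩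
    rw [onPath_iff, not_not]
    exact (key hx' hy').trans (key hx hy).symm

variable {τ} {r : ℕ} {e : ℕ → Sym2 τ.V}

lemma legDist_withLen (he : Set.BijOn e (Set.Icc 1 r) τ.G.edgeSet) (lam : Sym2 τ.V → ℝ)
    (α β : Fin n) :
    (τ.withLen lam).legDist α β = ∑ p ∈ Finset.Icc 1 r,
      lam (e p) * (if τ.onPath (τ.mark α) (τ.mark β) (e p) then 1 else 0) := by
  change ((τ.path (τ.mark α) (τ.mark β)).edges.map lam).sum = _
  have hnd := (τ.isPath_path (τ.mark α) (τ.mark β)).isTrail.edges_nodup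
  rw [← List.sum_toFinset lam hnd]
  simp only [mul_ite, mul_one, mul_zero]
  rw [← Finset.sum_filter]
  symm
  refine Finset.sum_bij (fun p _ => e p) ?_ ?_ ?_ ?_
  · intro p hp
    exact List.mem_toFinset.2 (Finset.mem_filter.1 hp).2
  · intro p hp p' hp' h
    simp only [Finset.mem_filter, Finset.mem_Icc] at hp hp'
    exact he.injOn hp.1 hp'.1 h
  · intro x hx
    rw [List.mem_toFinset] at hx
    obtain ⟨p, hp, rfl⟩ := he.surjOn (SimpleGraph.Walk.edges_subset_edgeSet _ hx)
    exact ⟨p, Finset.mem_filter.2 ⟨Finset.mem_Icc.2 hp, hx⟩, rfl⟩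
  · intros; rfl

lemma proj_withLen (he : Set.BijOn e (Set.Icc 1 r) τ.G.edgeSet) (lam : Sym2 τ.V → ℝ)
    (i j g : Fin n) :
    (τ.withLen lam).proj i j g = ∑ p ∈ Finset.Icc 1 r, lam (e p) *
      (((if τ.onPath (τ.mark i) (τ.mark g) (e p) then 1 else 0) +
        (if τ.onPath (τ.mark i) (τ.mark j) (e p) then 1 else 0) -
        (if τ.onPath (τ.mark j) (τ.mark g) (e p) then 1 else 0)) / 2) := by
  rw [MMTree.proj, legDist_withLen he, legDist_withLen he, legDist_withLen he,
    ← Finset.sum_add_distrib, ← Finset.sum_sub_distrib, Finset.sum_div]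
  exact Finset.sum_congr rfl fun p _ => by ring

/-- The difference of two projection coordinates is, up to a sign that depends only on the
underlying tree, the length of the common part of two paths. -/
lemma exists_sign_proj_sub (he : Set.BijOn e (Set.Icc 1 r) τ.G.edgeSet) (i j k l : Fin n) :
    ∃ σ : ℝ, (σ = 1 ∨ σ = -1) ∧ ∀ lam : Sym2 τ.V → ℝ,
      (τ.withLen lam).proj i j k - (τ.withLen lam).proj i j l =
        σ * ∑ p ∈ (Finset.Icc 1 r).filter (fun p => e p ∈ τ.PathSet i j k l), lam (e p) := by
  have main : ∀ σ : ℝ, (∀ x ∈ τ.PathSet i j k l,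
        (if τ.onPath (τ.mark i) (τ.mark k) x then (1 : ℝ) else -1) = σ) →
      ∀ lam : Sym2 τ.V → ℝ, (τ.withLen lam).proj i j k - (τ.withLen lam).proj i j l =
        σ * ∑ p ∈ (Finset.Icc 1 r).filter (fun p => e p ∈ τ.PathSet i j k l), lam (e p) := by
    intro σ hσ lam
    rw [proj_withLen he, proj_withLen he, ← Finset.sum_sub_distrib, Finset.sum_filter,
      Finset.mul_sum]
    refine Finset.sum_congr rfl fun p _ => ?_
    have hp := hσ (e p)
    have hP : e p ∈ τ.PathSet i j k l ↔ τ.onPath (τ.mark i) (τ.mark j) (e p) ∧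
        τ.onPath (τ.mark k) (τ.mark l) (e p) := Iff.rfl
    have hkl := τ.onPath_iff_xor (τ.mark i) (τ.mark k) (τ.mark l) (e p)
    have hjk := τ.onPath_iff_xor (τ.mark i) (τ.mark j) (τ.mark k) (e p)
    have hjl := τ.onPath_iff_xor (τ.mark i) (τ.mark j) (τ.mark l) (e p)
    by_cases h1 : τ.onPath (τ.mark i) (τ.mark j) (e p) <;>
    by_cases h2 : τ.onPath (τ.mark i) (τ.mark k) (e p) <;>
    by_cases h3 : τ.onPath (τ.mark i) (τ.mark l) (e p) <;>
    simp [h1, h2, h3, hP, hkl, hjk, hjl] at hp ⊢ <;>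
    (try rw [← hp]) <;> ring
  by_cases hx : ∃ x ∈ τ.PathSet i j k l, τ.onPath (τ.mark i) (τ.mark k) x
  · refine ⟨1, Or.inl rfl, main 1 ?_⟩
    obtain ⟨x, ⟨hij, hkl⟩, hik⟩ := hx
    rintro y ⟨hij', hkl'⟩
    by_contra hne
    have hik' : ¬ τ.onPath (τ.mark i) (τ.mark k) y := fun h => hne (if_pos h)
    have a1 := τ.onPath_iff_xor (τ.mark i) (τ.mark k) (τ.mark l) x
    have a2 := τ.onPath_iff_xor (τ.mark i) (τ.mark k) (τ.mark j) x
    have b1 := τ.onPath_iff_xor (τ.mark i) (τ.mark k) (τ.mark l) y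
    have b2 := τ.onPath_iff_xor (τ.mark i) (τ.mark k) (τ.mark j) y
    refine τ.not_onPath_of_split (x := x) (y := y) (i := τ.mark i) (j := τ.mark j)
      (k := τ.mark k) (l := τ.mark l) ?_ ?_ ?_ ?_ hik <;> tauto
  · push Not at hx
    exact ⟨-1, Or.inr rfl, main (-1) fun x hxP => if_neg (hx x hxP)⟩

lemma abs_proj_sub_le (he : Set.BijOn e (Set.Icc 1 r) τ.G.edgeSet) {lam lam' : Sym2 τ.V → ℝ}
    {ε : ℝ} (hε : ∀ x ∈ τ.G.edgeSet, |lam' x - lam x| < ε) (i j g : Fin n) :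
    |(τ.withLen lam').proj i j g - (τ.withLen lam).proj i j g| ≤ r * ε := by
  rw [proj_withLen he, proj_withLen he, ← Finset.sum_sub_distrib]
  refine (Finset.abs_sum_le_sum_abs _ _).trans ?_
  refine (Finset.sum_le_card_nsmul _ _ ε fun p hp => ?_).trans (by simp)
  have h := (hε _ (he.mapsTo (Finset.mem_Icc.1 hp))).le
  rw [← sub_mul, abs_mul]
  refine le_trans (mul_le_of_le_one_right (abs_nonneg _) ?_) h
  rw [abs_le]
  split_ifs <;> norm_num

lemma PathSet_comm (i j k l : Fin n) : τ.PathSet i j k l = τ.PathSet i j l k := by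
  ext x
  simp only [PathSet, Set.mem_ofPred_eq, τ.onPath_comm (τ.mark k)]

end MTree

lemma sum_Ioc_pow_sub_mul (B : ℝ) {N q r : ℕ} (hqr : q ≤ r) (hrN : r ≤ N) :
    (∑ s ∈ Finset.Ioc q r, B ^ (N - s)) * (B - 1) = B ^ (N - q) - B ^ (N - r) := by
  induction r, hqr using Nat.le_induction with
  | base => simp
  | succ r hqr ih =>
    rw [← Finset.insert_Ioc_right_eq_Ioc_add_one hqr, Finset.sum_insert (by simp), add_mul,
      ih (by omega), show N - r = N - (r + 1) + 1 by omega, pow_succ]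
    ring

lemma eq_self_of_strictMonoOn_Icc {r : ℕ} {f : ℕ → ℕ} (hf : StrictMonoOn f (Set.Icc 1 r))
    (hm : Set.MapsTo f (Set.Icc 1 r) (Set.Icc 1 r)) {q : ℕ} (hq : q ∈ Set.Icc 1 r) :
    f q = q := by
  have lo : ∀ m, m ∈ Set.Icc 1 r → m ≤ f m := by
    intro m
    induction m with
    | zero => intro h; simp
    | succ m ih =>
      intro h
      rcases Nat.eq_zero_or_pos m with rfl | h0
      · exact (hm h).1
      · have hm' : m ∈ Set.Icc 1 r := ⟨h0, by have := h.2; omega⟩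
        have := hf hm' h (Nat.lt_succ_self m)
        have := ih hm'
        omega
  have hi : ∀ d, d < r → f (r - d) ≤ r - d := by
    intro d
    induction d with
    | zero => intro h; exact (hm ⟨by omega, by omega⟩).2
    | succ d ih =>
      intro h
      have := hf (a := r - (d + 1)) (b := r - d)
        ⟨by omega, by omega⟩ ⟨by omega, by omega⟩ (by omega)
      have := ih (by omega)
      omega
  obtain ⟨h1, h2⟩ := hq
  have := hi (r - q) (by omega)
  rw [show r - (r - q) = q by omega] at this
  exact le_antisymm this (lo q ⟨h1, h2⟩)

/-- A `0`-`1` system of equations with positive decreasing solution and rapidly decreasing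
right-hand sides is upper unitriangular. -/
lemma upper_triangular_of_sum_eq {r N : ℕ} (hrN : r ≤ N) {B M : ℝ} (hM : 0 ≤ M)
    (hB : 2 * M + 1 < B) {P : ℕ → ℕ → Prop} {x t : ℕ → ℝ}
    (hx : ∀ p ∈ Set.Icc 1 r, 0 < x p) (hanti : StrictAntiOn x (Set.Icc 1 r))
    (ht : ∀ q ∈ Set.Icc 1 r, 1 ≤ t q ∧ t q ≤ M)
    (hsum : ∀ q ∈ Set.Icc 1 r, ∑ p ∈ (Finset.Icc 1 r).filter (P q), x p = t q * B ^ (N - q))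
    {q : ℕ} (hq : q ∈ Set.Icc 1 r) : P q q ∧ ∀ p, 1 ≤ p → p < q → ¬ P q p := by
  have hc : ∀ s, 0 < B ^ (N - s) := fun s => pow_pos (by linarith) _
  have tail : ∀ q ∈ Set.Icc 1 r,
      2 * ∑ s ∈ Finset.Ioc q r, M * B ^ (N - s) < B ^ (N - q) := by
    intro q hq
    have h := sum_Ioc_pow_sub_mul B hq.2 hrN
    have h0 : 0 ≤ ∑ s ∈ Finset.Ioc q r, B ^ (N - s) := Finset.sum_nonneg fun s _ => (hc s).le
    rw [← Finset.mul_sum]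
    nlinarith [hc r, hc q]
  have bound : ∀ q ∈ Set.Icc 1 r, t q * B ^ (N - q) ≤ M * B ^ (N - q) := fun q hq =>
    mul_le_mul_of_nonneg_right (ht q hq).2 (hc q).le
  have lower : ∀ q ∈ Set.Icc 1 r, B ^ (N - q) ≤ t q * B ^ (N - q) := fun q hq =>
    le_mul_of_one_le_left (hc q).le (ht q hq).1
  have single : ∀ q ∈ Set.Icc 1 r, ∀ p ∈ Set.Icc 1 r, P q p → x p ≤ M * B ^ (N - q) := by
    intro q hq p hp hqp
    refine le_trans ?_ (bound q hq)
    rw [← hsum q hq]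
    exact Finset.single_le_sum (f := x)
      (fun p hp => (hx p (Finset.mem_Icc.1 (Finset.mem_filter.1 hp).1)).le)
      (Finset.mem_filter.2 ⟨Finset.mem_Icc.2 hp, hqp⟩)
  have ex : ∀ q, ∃ p, q ∈ Set.Icc 1 r →
      p ∈ Set.Icc 1 r ∧ P q p ∧ ∀ s, q < s → s ≤ r → ¬ P s p := by
    intro q
    by_cases hq : q ∈ Set.Icc 1 r
    swap
    · exact ⟨0, fun h => absurd h hq⟩
    by_contra! hcon
    have hcon' : ∀ p ∈ Set.Icc 1 r, P q p → ∃ s, q < s ∧ s ≤ r ∧ P s p :=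
      fun p hp hqp => (hcon p).2 hp hqp
    have : ∑ p ∈ (Finset.Icc 1 r).filter (P q), x p ≤
        ∑ s ∈ Finset.Ioc q r, M * B ^ (N - s) := by
      calc ∑ p ∈ (Finset.Icc 1 r).filter (P q), x p
          ≤ ∑ p ∈ Finset.Icc 1 r, ∑ s ∈ Finset.Ioc q r, if P s p then x p else 0 := by
            rw [Finset.sum_filter]
            refine Finset.sum_le_sum fun p hp => ?_
            have hp' := Finset.mem_Icc.1 hp
            have nn : ∀ s ∈ Finset.Ioc q r, 0 ≤ if P s p then x p else 0 := by
              intro s _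
              split_ifs
              exacts [(hx p hp').le, le_rfl]
            split_ifs with h
            · obtain ⟨s, h1, h2, h3⟩ := hcon' p hp' h
              refine le_trans ?_ (Finset.single_le_sum nn (Finset.mem_Ioc.2 ⟨h1, h2⟩))
              rw [if_pos h3]
            · exact Finset.sum_nonneg nn
        _ = ∑ s ∈ Finset.Ioc q r, ∑ p ∈ (Finset.Icc 1 r).filter (P s), x p := by
            rw [Finset.sum_comm]
            simp only [Finset.sum_filter]
        _ ≤ _ := by
            refine Finset.sum_le_sum fun s hs => ?_
            have hs' : s ∈ Set.Icc 1 r :=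
              ⟨hq.1.trans (Finset.mem_Ioc.1 hs).1.le, (Finset.mem_Ioc.1 hs).2⟩
            rw [hsum s hs']
            exact bound s hs'
    rw [hsum q hq] at this
    linarith [tail q hq, lower q hq, hc q]
  choose f hf using ex
  have hmaps : Set.MapsTo f (Set.Icc 1 r) (Set.Icc 1 r) := fun q hq => (hf q hq).1
  have hinj : Set.InjOn f (Set.Icc 1 r) := by
    intro a ha b hb hab
    by_contra hne
    rcases lt_or_gt_of_ne hne with h | h
    · exact (hf a ha).2.2 b h hb.2 (hab ▸ (hf b hb).2.1)
    · exact (hf b hb).2.2 a h ha.2 (hab ▸ (hf a ha).2.1)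
  have hsurj : Set.SurjOn f (Set.Icc 1 r) (Set.Icc 1 r) :=
    Finset.coe_Icc 1 r ▸ Finset.surjOn_of_injOn_of_card_le (s := Finset.Icc 1 r)
      (t := Finset.Icc 1 r) f (by rwa [Finset.coe_Icc]) (by rwa [Finset.coe_Icc]) le_rfl
  have mem : ∀ q ∈ Set.Icc 1 r, ∀ p ∈ Set.Icc 1 r, P q p → ∃ s ∈ Set.Icc 1 r, q ≤ s ∧ f s = p := by
    intro q hq p hp hqp
    obtain ⟨s, hs, rfl⟩ := hsurj hp
    refine ⟨s, hs, ?_, rfl⟩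
    by_contra! h
    exact (hf s hs).2.2 q h hq.2 hqp
  have big : ∀ q ∈ Set.Icc 1 r, B ^ (N - q) < 2 * x (f q) := by
    intro q hq
    have : ∑ p ∈ (Finset.Icc 1 r).filter (P q), x p ≤
        ∑ s ∈ Finset.Icc q r, x (f s) := by
      have hinj' : Set.InjOn f (Finset.Icc q r : Set ℕ) := hinj.mono (by
        rw [Finset.coe_Icc]; exact Set.Icc_subset_Icc_left hq.1)
      rw [← Finset.sum_image (g := f) (f := x) hinj']
      refine Finset.sum_le_sum_of_subset_of_nonneg ?_ ?_
      · intro p hp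
        rw [Finset.mem_filter, Finset.mem_Icc] at hp
        obtain ⟨s, hs, hqs, rfl⟩ := mem q hq p hp.1 hp.2
        exact Finset.mem_image_of_mem _ (Finset.mem_Icc.2 ⟨hqs, hs.2⟩)
      · intro p hp _
        obtain ⟨s, hs, rfl⟩ := Finset.mem_image.1 hp
        rw [Finset.mem_Icc] at hs
        exact (hx _ (hmaps ⟨hq.1.trans hs.1, hs.2⟩)).le
    rw [hsum q hq, ← Finset.add_sum_Ioc_eq_sum_Icc hq.2] at this
    have h2 : ∑ s ∈ Finset.Ioc q r, x (f s) ≤ ∑ s ∈ Finset.Ioc q r, M * B ^ (N - s) := by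
      refine Finset.sum_le_sum fun s hs => ?_
      have hs' : s ∈ Set.Icc 1 r :=
        ⟨hq.1.trans (Finset.mem_Ioc.1 hs).1.le, (Finset.mem_Ioc.1 hs).2⟩
      exact single s hs' _ (hmaps hs') (hf s hs').2.1
    linarith [tail q hq, lower q hq]
  have hmono : StrictMonoOn f (Set.Icc 1 r) := by
    intro a ha b hb hab
    by_contra! h
    have h1 : x (f a) ≤ x (f b) := hanti.antitoneOn (hmaps hb) (hmaps ha) h
    have h2 : M * B ^ (N - b) ≤ ∑ s ∈ Finset.Ioc a r, M * B ^ (N - s) :=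
      Finset.single_le_sum (f := fun s => M * B ^ (N - s))
        (fun s _ => mul_nonneg hM (hc s).le) (Finset.mem_Ioc.2 ⟨hab, hb.2⟩)
    linarith [tail a ha, big a ha, single b hb _ (hmaps hb) (hf b hb).2.1]
  have hid : ∀ {q}, q ∈ Set.Icc 1 r → f q = q := eq_self_of_strictMonoOn_Icc hmono hmaps
  refine ⟨?_, fun p h1 hpq hP => ?_⟩
  · simpa only [hid hq] using (hf q hq).2.1
  · have hp : p ∈ Set.Icc 1 r := ⟨h1, hpq.le.trans hq.2⟩
    exact (hf p hp).2.2 q hpq hq.2 ((hid hp).symm ▸ hP)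

lemma eq_of_upper_triangular {r : ℕ} {P : ℕ → ℕ → Prop} {x y : ℕ → ℝ}
    (hP : ∀ q, 1 ≤ q → q ≤ r → P q q ∧ ∀ p, 1 ≤ p → p < q → ¬ P q p)
    (hxy : ∀ q, 1 ≤ q → q ≤ r → ∑ p ∈ (Finset.Icc 1 r).filter (P q), x p =
      ∑ p ∈ (Finset.Icc 1 r).filter (P q), y p) {q : ℕ} (h1 : 1 ≤ q) (h2 : q ≤ r) :
    x q = y q := by
  induction hd : r - q using Nat.strong_induction_on generalizing q with
  | _ d ih =>
    have h := sub_eq_zero.2 (hxy q h1 h2)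
    rw [← Finset.sum_sub_distrib, Finset.sum_eq_single_of_mem q
      (Finset.mem_filter.2 ⟨Finset.mem_Icc.2 ⟨h1, h2⟩, (hP q h1 h2).1⟩)] at h
    · exact sub_eq_zero.1 h
    · intro p hp hne
      rw [Finset.mem_filter, Finset.mem_Icc] at hp
      have hqp : q < p := by
        by_contra! hle
        exact (hP q h1 h2).2 p hp.1.1 (lt_of_le_of_ne hle hne) hp.2
      exact sub_eq_zero.2 (ih (r - p) (by omega) hp.1.1 hp.1.2 rfl)


/-- Proposition that `Trop(H_q)` is cut out near `Γ` by the
`q`-th row of the path matrix equation, Section 6. -/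
theorem statement_7
    (n r : ℕ) (hn : 3 ≤ n) (hr1 : 1 ≤ r) (hrn : r ≤ n - 3)
    (S : ℕ → Finset (Fin n)) (i j : ℕ → Fin n)
    (hScard : ∀ q, 1 ≤ q → q ≤ r → 3 ≤ (S q).card)
    (hiS : ∀ q, 1 ≤ q → q ≤ r → i q ∈ S q)
    (hjS : ∀ q, 1 ≤ q → q ≤ r → j q ∈ S q)
    (hij : ∀ q, 1 ≤ q → q ≤ r → i q ≠ j q)
    (B : ℝ) (hB : 2 * (n : ℝ) + 1 ≤ B)
    (Γ : MMTree n) (hpos : Γ.PosLen) (hstab : Γ.toMTree.Stable)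
    (hedge : Γ.G.edgeSet.ncard ≤ r)
    (hH : ∀ q, 1 ≤ q → q ≤ r → Γ.CondH (S q) (i q) (j q) (B ^ (n - 3 - q)))
    -- the edges of `Γ` listed in decreasing order of length
    (e : ℕ → Sym2 Γ.V)
    (he : ∀ q, 1 ≤ q → q ≤ r → e q ∈ Γ.G.edgeSet)
    (hdec : ∀ q q', 1 ≤ q → q < q' → q' ≤ r →
      e q ≠ e q' ∧ Γ.len (e q') < Γ.len (e q))
    -- the two minimizers `k_q < l_q` of `(H_q)`
    (k l : ℕ → Fin n)
    (hmin : ∀ q, 1 ≤ q → q ≤ r →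
      Γ.Minimizes (S q) (i q) (j q) (B ^ (n - 3 - q)) (k q) ∧
      Γ.Minimizes (S q) (i q) (j q) (B ^ (n - 3 - q)) (l q) ∧ k q < l q) :
    -- (a) the total length of `P_q` equals `(l_q − k_q)·B^(n−3−q)` …
    (∀ q, 1 ≤ q → q ≤ r →
      (∑ q' ∈ (Finset.Icc 1 r).filter
          (fun q' => e q' ∈ Γ.toMTree.PathSet (i q) (j q) (k q) (l q)),
          Γ.len (e q')) =
        (((l q : ℕ) : ℝ) - ((k q : ℕ) : ℝ)) * B ^ (n - 3 - q)) ∧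
    -- … the coefficient matrix is upper triangular with `1`s on the diagonal …
    (∀ q, 1 ≤ q → q ≤ r →
      e q ∈ Γ.toMTree.PathSet (i q) (j q) (k q) (l q) ∧
      ∀ q', 1 ≤ q' → q' < q →
        e q' ∉ Γ.toMTree.PathSet (i q) (j q) (k q) (l q)) ∧
    -- … and these `r` linear equations determine the edge lengths uniquely
    (∀ lam' : Sym2 Γ.V → ℝ,
      (∀ q, 1 ≤ q → q ≤ r →
        (∑ q' ∈ (Finset.Icc 1 r).filter
            (fun q' => e q' ∈ Γ.toMTree.PathSet (i q) (j q) (k q) (l q)),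
            lam' (e q')) =
          (((l q : ℕ) : ℝ) - ((k q : ℕ) : ℝ)) * B ^ (n - 3 - q)) →
      ∀ q, 1 ≤ q → q ≤ r → lam' (e q) = Γ.len (e q)) ∧
    -- (b) near `Γ`, the tropical hypersurface `Trop(H_q)` is cut out by the
    -- `q`-th path-length equation
    ∃ ε : ℝ, 0 < ε ∧
      ∀ q, 1 ≤ q → q ≤ r →
      ∀ lam' : Sym2 Γ.V → ℝ,
        (∀ ed ∈ Γ.G.edgeSet, 0 < lam' ed ∧ |lam' ed - Γ.len ed| < ε) →
        ((Γ.toMTree.withLen lam').CondH (S q) (i q) (j q) (B ^ (n - 3 - q)) ↔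
          (∑ q' ∈ (Finset.Icc 1 r).filter
              (fun q' => e q' ∈ Γ.toMTree.PathSet (i q) (j q) (k q) (l q)),
              lam' (e q')) =
            (((l q : ℕ) : ℝ) - ((k q : ℕ) : ℝ)) * B ^ (n - 3 - q)) := by
  have hbij : Set.BijOn e (Set.Icc 1 r) Γ.toMTree.G.edgeSet := by
    have hm : Set.MapsTo e (Set.Icc 1 r) Γ.toMTree.G.edgeSet := fun q hq => he q hq.1 hq.2
    have hi : Set.InjOn e (Set.Icc 1 r) := by
      intro a ha b hb hab
      by_contra hne
      rcases lt_or_gt_of_ne hne with h | h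
      · exact (hdec a b ha.1 h hb.2).1 hab
      · exact (hdec b a hb.1 h ha.2).1 hab.symm
    refine ⟨hm, hi, (Set.eq_of_subset_of_ncard_le hm.image_subset ?_ (Set.toFinite _)).ge⟩
    rw [hi.ncard_image, ← Finset.coe_Icc, Set.ncard_coe_finset, Nat.card_Icc]
    exact hedge
  have hxpos : ∀ p ∈ Set.Icc 1 r, 0 < Γ.len (e p) := fun p hp => hpos _ (hbij.mapsTo hp)
  have hanti : StrictAntiOn (fun p => Γ.len (e p)) (Set.Icc 1 r) :=
    fun a ha b hb hab => (hdec a b ha.1 hab hb.2).2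
  have hn' : (3 : ℝ) ≤ n := by exact_mod_cast hn
  have hcpos : ∀ q, 0 < B ^ (n - 3 - q) := fun q => pow_pos (by linarith) _
  -- any two distinct minimizers determine the length function along their common path
  have hlin : ∀ q, 1 ≤ q → q ≤ r → ∀ a b : Fin n, a < b →
      Γ.Minimizes (S q) (i q) (j q) (B ^ (n - 3 - q)) a →
      Γ.Minimizes (S q) (i q) (j q) (B ^ (n - 3 - q)) b →
      (∀ lam : Sym2 Γ.toMTree.V → ℝ,
        (Γ.toMTree.withLen lam).proj (i q) (j q) a - (Γ.toMTree.withLen lam).proj (i q) (j q) b =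
          ∑ p ∈ (Finset.Icc 1 r).filter (fun p => e p ∈ Γ.toMTree.PathSet (i q) (j q) a b), lam (e p)) ∧
      ∑ p ∈ (Finset.Icc 1 r).filter (fun p => e p ∈ Γ.toMTree.PathSet (i q) (j q) a b), Γ.len (e p) =
        (((b : ℕ) : ℝ) - ((a : ℕ) : ℝ)) * B ^ (n - 3 - q) := by
    intro q h1 h2 a b hab ha hb
    obtain ⟨σ, hσ, hformula⟩ := MTree.exists_sign_proj_sub hbij (i q) (j q) a b
    have heq : Γ.proj (i q) (j q) a - Γ.proj (i q) (j q) b =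
        (((b : ℕ) : ℝ) - ((a : ℕ) : ℝ)) * B ^ (n - 3 - q) := by
      have := le_antisymm (ha.2 b hb.1) (hb.2 a ha.1)
      simp only [MMTree.hval] at this
      linarith
    have hΓ := hformula Γ.len
    change Γ.proj (i q) (j q) a - Γ.proj (i q) (j q) b = _ at hΓ
    have hab' : ((a : ℕ) : ℝ) < ((b : ℕ) : ℝ) := by exact_mod_cast hab
    have hrhs := mul_pos (sub_pos.2 hab') (hcpos q)
    have hnn : 0 ≤ ∑ p ∈ (Finset.Icc 1 r).filter
        (fun p => e p ∈ Γ.toMTree.PathSet (i q) (j q) a b), Γ.len (e p) :=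
      Finset.sum_nonneg fun p hp => (hxpos p (Finset.mem_Icc.1 (Finset.mem_filter.1 hp).1)).le
    rcases hσ with rfl | rfl
    · simp only [one_mul] at hformula hΓ
      exact ⟨hformula, hΓ ▸ heq⟩
    · linarith
  have hdiff : ∀ a b : Fin n, a < b →
      1 ≤ ((b : ℕ) : ℝ) - ((a : ℕ) : ℝ) ∧ ((b : ℕ) : ℝ) - ((a : ℕ) : ℝ) ≤ (n : ℝ) - 1 := by
    intro a b hab
    have h1 : ((a : ℕ) : ℝ) + 1 ≤ ((b : ℕ) : ℝ) := by exact_mod_cast hab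
    have h2 : ((b : ℕ) : ℝ) + 1 ≤ (n : ℝ) := by exact_mod_cast b.2
    have h3 : (0 : ℝ) ≤ ((a : ℕ) : ℝ) := Nat.cast_nonneg _
    constructor <;> linarith
  have htri : ∀ k l : ℕ → Fin n, (∀ q, 1 ≤ q → q ≤ r →
      Γ.Minimizes (S q) (i q) (j q) (B ^ (n - 3 - q)) (k q) ∧
      Γ.Minimizes (S q) (i q) (j q) (B ^ (n - 3 - q)) (l q) ∧ k q < l q) →
      ∀ q, 1 ≤ q → q ≤ r → e q ∈ Γ.toMTree.PathSet (i q) (j q) (k q) (l q) ∧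
        ∀ p, 1 ≤ p → p < q → e p ∉ Γ.toMTree.PathSet (i q) (j q) (k q) (l q) := by
    intro k l hmin q h1 h2
    refine upper_triangular_of_sum_eq (N := n - 3) (B := B) (M := (n : ℝ) - 1)
      (P := fun q p => e p ∈ Γ.toMTree.PathSet (i q) (j q) (k q) (l q))
      (x := fun p => Γ.len (e p)) (t := fun q => ((l q : ℕ) : ℝ) - ((k q : ℕ) : ℝ))
      hrn (by linarith) (by linarith) hxpos hanti
      (fun q hq => hdiff _ _ (hmin q hq.1 hq.2).2.2) (fun q hq => ?_) ⟨h1, h2⟩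
    obtain ⟨ha, hb, hab⟩ := hmin q hq.1 hq.2
    exact (hlin q hq.1 hq.2 _ _ hab ha hb).2
  have hdiag : ∀ q, 1 ≤ q → q ≤ r → ∀ a b : Fin n, a ≠ b →
      Γ.Minimizes (S q) (i q) (j q) (B ^ (n - 3 - q)) a →
      Γ.Minimizes (S q) (i q) (j q) (B ^ (n - 3 - q)) b →
      e q ∈ Γ.toMTree.PathSet (i q) (j q) a b := by
    intro q h1 h2
    have lt_case : ∀ a b : Fin n, a < b →
        Γ.Minimizes (S q) (i q) (j q) (B ^ (n - 3 - q)) a →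
        Γ.Minimizes (S q) (i q) (j q) (B ^ (n - 3 - q)) b →
        e q ∈ Γ.toMTree.PathSet (i q) (j q) a b := by
      intro a b hab ha hb
      have := (htri (Function.update k q a) (Function.update l q b) (fun s hs1 hs2 => by
        by_cases hs : s = q
        · subst hs
          simpa using ⟨ha, hb, hab⟩
        · simpa [hs] using hmin s hs1 hs2) q h1 h2).1
      simpa using this
    intro a b hne ha hb
    rcases lt_or_gt_of_ne hne with h | h
    · exact lt_case a b h ha hb
    · rw [MTree.PathSet_comm]
      exact lt_case b a h hb ha
  have honly : ∀ q, 1 ≤ q → q ≤ r → ∀ g : Fin n,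
      Γ.Minimizes (S q) (i q) (j q) (B ^ (n - 3 - q)) g → g = k q ∨ g = l q := by
    intro q h1 h2 g hg
    obtain ⟨hk, hl, hkl⟩ := hmin q h1 h2
    by_contra! hne
    have a1 := (hdiag q h1 h2 _ _ hkl.ne hk hl).2
    have a2 := (hdiag q h1 h2 _ _ hne.1 hg hk).2
    have a3 := (hdiag q h1 h2 _ _ hne.2 hg hl).2
    exact (Γ.toMTree.onPath_iff_xor (Γ.toMTree.mark g) _ _ _).1 a1 (iff_of_true a2 a3)
  have hgap : ∀ q, 1 ≤ q → q ≤ r → ∀ g ∈ S q \ {i q, j q}, g ≠ k q → g ≠ l q →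
      0 < Γ.hval (i q) (j q) (B ^ (n - 3 - q)) g -
        Γ.hval (i q) (j q) (B ^ (n - 3 - q)) (k q) := by
    intro q h1 h2 g hg hgk hgl
    by_contra! hle
    rcases honly q h1 h2 g ⟨hg, fun γ hγ =>
      (sub_nonpos.1 hle).trans ((hmin q h1 h2).1.2 γ hγ)⟩ with h | h
    exacts [hgk h, hgl h]
  have hcut := fun q h1 h2 => hlin q h1 h2 (k q) (l q) (hmin q h1 h2).2.2 (hmin q h1 h2).1
    (hmin q h1 h2).2.1
  refine ⟨fun q h1 h2 => (hcut q h1 h2).2, htri k l hmin, ?_, ?_⟩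
  · intro lam' hlam' q h1 h2
    exact eq_of_upper_triangular (x := fun p => lam' (e p)) (y := fun p => Γ.len (e p))
      (htri k l hmin) (fun q h1 h2 => (hlam' q h1 h2).trans (hcut q h1 h2).2.symm) h1 h2
  have hε : ∃ ε : ℝ, 0 < ε ∧ ∀ q ∈ Finset.Icc 1 r, ∀ g ∈ (S q \ {i q, j q}) \ {k q, l q},
      2 * (r * ε) < Γ.hval (i q) (j q) (B ^ (n - 3 - q)) g -
        Γ.hval (i q) (j q) (B ^ (n - 3 - q)) (k q) := by
    have hev : ∀ᶠ ε in nhdsWithin (0 : ℝ) (Set.Ioi 0),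
        ∀ q ∈ Finset.Icc 1 r, ∀ g ∈ (S q \ {i q, j q}) \ {k q, l q},
        2 * (r * ε) < Γ.hval (i q) (j q) (B ^ (n - 3 - q)) g -
          Γ.hval (i q) (j q) (B ^ (n - 3 - q)) (k q) := by
      rw [Filter.eventually_all_finset]
      intro q hq
      rw [Filter.eventually_all_finset]
      intro g hg
      rw [Finset.mem_Icc] at hq
      rw [Finset.mem_sdiff, Finset.mem_insert, Finset.mem_singleton, not_or] at hg
      have hcont : Continuous fun ε : ℝ => 2 * (r * ε) := by fun_prop
      refine ((hcont.tendsto 0).mono_left nhdsWithin_le_nhds).eventually_lt_const ?_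
      simpa using hgap q hq.1 hq.2 g hg.1 hg.2.1 hg.2.2
    obtain ⟨ε, h, hε⟩ := (hev.and self_mem_nhdsWithin).exists
    exact ⟨ε, hε, h⟩
  obtain ⟨ε, hε0, hε⟩ := hε
  refine ⟨ε, hε0, fun q h1 h2 lam' hlam' => ?_⟩
  obtain ⟨hk, hl, hkl⟩ := hmin q h1 h2
  have hpert := MTree.abs_proj_sub_le hbij (fun x hx => (hlam' x hx).2) (i q) (j q)
  change ∀ g, |_ - Γ.proj (i q) (j q) g| ≤ _ at hpert
  have hfar : ∀ g ∈ S q \ {i q, j q}, g ≠ k q → g ≠ l q →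
      (Γ.toMTree.withLen lam').hval (i q) (j q) (B ^ (n - 3 - q)) (k q) <
        (Γ.toMTree.withLen lam').hval (i q) (j q) (B ^ (n - 3 - q)) g := by
    intro g hg hgk hgl
    have h := hε q (Finset.mem_Icc.2 ⟨h1, h2⟩) g (by simp only [Finset.mem_sdiff,
      Finset.mem_insert, Finset.mem_singleton, not_or] at hg ⊢; exact ⟨hg, hgk, hgl⟩)
    have hpk := abs_le.1 (hpert (k q))
    have hpg := abs_le.1 (hpert g)
    simp only [MMTree.hval] at h ⊢
    linarith
  have hiff : (Γ.toMTree.withLen lam').hval (i q) (j q) (B ^ (n - 3 - q)) (k q) =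
      (Γ.toMTree.withLen lam').hval (i q) (j q) (B ^ (n - 3 - q)) (l q) ↔
      ∑ p ∈ (Finset.Icc 1 r).filter (fun p => e p ∈ Γ.toMTree.PathSet (i q) (j q) (k q) (l q)),
        lam' (e p) = (((l q : ℕ) : ℝ) - ((k q : ℕ) : ℝ)) * B ^ (n - 3 - q) := by
    rw [← (hcut q h1 h2).1 lam']
    simp only [MMTree.hval]
    constructor <;> intro h <;> linarith
  rw [← hiff]
  constructor
  · rintro ⟨a, b, hne, ha, hb⟩
    have near : ∀ g, (Γ.toMTree.withLen lam').Minimizes (S q) (i q) (j q) (B ^ (n - 3 - q)) g →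
        g = k q ∨ g = l q := by
      intro g hg
      by_contra! hgne
      exact absurd (hg.2 _ hk.1) (not_le.2 (hfar g hg.1 hgne.1 hgne.2))
    have hab := le_antisymm (ha.2 b hb.1) (hb.2 a ha.1)
    rcases near a ha with rfl | rfl <;> rcases near b hb with rfl | rfl
    exacts [absurd rfl hne, hab, hab.symm, absurd rfl hne]
  · intro h
    have hkmin : (Γ.toMTree.withLen lam').Minimizes (S q) (i q) (j q) (B ^ (n - 3 - q)) (k q) := by
      refine ⟨hk.1, fun g hg => ?_⟩
      by_cases hgk : g = k q
      · rw [hgk]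
      by_cases hgl : g = l q
      · rw [hgl, h]
      exact (hfar g hg hgk hgl).le
    exact ⟨k q, l q, hkl.ne, hkmin, hl.1, fun g hg => h ▸ hkmin.2 g hg⟩

end TropPsi
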